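/- Birch's theorem: Let A be an m×(n+1) matrix of nonnegative integers with all column sums equal, defining the toric model M = closure of {(θ^{A_0},...,θ^{A_n}) : θ in (R_{>0})^m} intersected with the probability simplex. For a vector u of positive reals with sum 1, a point p in M with all positive coordinates is the maximum likelihood estimate for u if and only if A p = A u. -/

import Mathlib

open Real in
/-- Birch's theorem: Let `A` be an `m × (n+1)` matrix of natural
numbers with all column sums equal.  The toric model `M` is the closure of the
set of points `(θ^{A_0}, …, θ^{A_n})` for `θ ∈ (ℝ_{>0})^m`, intersected with the
probability simplex.  For positive `u` summing to `1`, a point `p ∈ M` with all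
positive coordinates (summing to `1`) is the maximum likelihood estimate for `u`
(i.e. maximizes `∏ pᵢ^{uᵢ}` over the model in the open simplex) if and only if
`A p = A u`. -/
theorem stmt3 (m n : ℕ) (A : Matrix (Fin m) (Fin (n + 1)) ℕ) (c : ℕ)
    (hcol : ∀ i, ∑ j, A j i = c)
    (u : Fin (n + 1) → ℝ) (hu : ∀ i, 0 < u i) (husum : ∑ i, u i = 1)
    (M : Set (Fin (n + 1) → ℝ))
    (hM : M = closure {q : Fin (n + 1) → ℝ |
        ∃ θ : Fin m → ℝ, (∀ j, 0 < θ j) ∧ ∀ i, q i = ∏ j, θ j ^ A j i})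
    (p : Fin (n + 1) → ℝ) (hpM : p ∈ M) (hp : ∀ i, 0 < p i) (hpsum : ∑ i, p i = 1) :
    (∀ q ∈ M, (∀ i, 0 < q i) → ∑ i, q i = 1 →
        ∏ i, q i ^ u i ≤ ∏ i, p i ^ u i)
      ↔ (A.map (Nat.cast : ℕ → ℝ)).mulVec p = (A.map (Nat.cast : ℕ → ℝ)).mulVec u := by
  classical
  set S : Set (Fin (n + 1) → ℝ) := {q : Fin (n + 1) → ℝ |
        ∃ θ : Fin m → ℝ, (∀ j, 0 < θ j) ∧ ∀ i, q i = ∏ j, θ j ^ A j i} with hS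
  have hlogprod : ∀ q : Fin (n + 1) → ℝ, (∀ i, 0 < q i) →
      ∏ i, q i ^ u i = Real.exp (∑ i, u i * Real.log (q i)) := by
    intro q hq
    rw [Real.exp_sum]
    refine Finset.prod_congr rfl fun i _ => ?_
    rw [Real.rpow_def_of_pos (hq i), mul_comm]
  have hmul : ∀ y ∈ S, ∀ x ∈ M, (fun i => x i * y i) ∈ M := by
    rintro y ⟨θ, hθ, hy⟩ x hx
    rw [hM] at hx ⊢
    have hc : Continuous (fun x : Fin (n + 1) → ℝ => fun i => x i * y i) := by fun_prop
    refine map_mem_closure hc hx ?_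
    rintro z ⟨η, hη, hz⟩
    refine ⟨fun j => η j * θ j, fun j => mul_pos (hη j) (hθ j), fun i => ?_⟩
    simp only [hz i, hy i, mul_pow, Finset.prod_mul_distrib]
  constructor
  · intro hmax
    funext j
    simp only [Matrix.mulVec, dotProduct, Matrix.map_apply]
    rcases Nat.eq_zero_or_pos c with hc | hc
    · have hA : ∀ i, A j i = 0 := by
        intro i
        have := hcol i
        rw [hc, Finset.sum_eq_zero_iff] at this
        exact this j (Finset.mem_univ j)
      simp [hA]
    set b : ℝ := ∑ i, (A j i : ℝ) * u i with hb
    set Z : ℝ → ℝ := fun t => ∑ i, p i * Real.exp (t * (A j i : ℝ)) with hZ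
    have hZpos : ∀ t, 0 < Z t := fun t =>
      Finset.sum_pos (fun i _ => mul_pos (hp i) (Real.exp_pos _)) Finset.univ_nonempty
    have key : ∀ t, Real.exp (t * b) ≤ Z t := by
      intro t
      set y : Fin (n + 1) → ℝ := fun i => Real.exp (t * (A j i : ℝ)) * (Z t)⁻¹ with hy
      have hyS : y ∈ S := by
        refine ⟨fun k => (if k = j then Real.exp t else 1) * ((Z t)⁻¹ ^ ((c : ℝ)⁻¹)),
          fun k => ?_, fun i => ?_⟩
        · have h1 := Real.rpow_pos_of_pos (inv_pos.mpr (hZpos t)) ((c : ℝ)⁻¹)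
          have h2 := Real.exp_pos t
          dsimp only
          split_ifs <;> positivity
        · simp only [mul_pow, Finset.prod_mul_distrib, Finset.prod_pow_eq_pow_sum, hcol i]
          rw [Real.rpow_inv_natCast_pow (inv_pos.mpr (hZpos t)).le hc.ne']
          have : ∏ k, (if k = j then Real.exp t else 1) ^ A k i = Real.exp t ^ A j i := by
            rw [Finset.prod_eq_single j]
            · simp
            · intro k _ hk
              simp [hk]
            · simp
          rw [this, ← Real.exp_nat_mul, mul_comm _ t]
      have hq := hmax _ (hmul y hyS p hpM)
        (fun i => mul_pos (hp i) (mul_pos (Real.exp_pos _) (inv_pos.mpr (hZpos t))))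
        (by
          simp only [hy, ← mul_assoc]
          rw [← Finset.sum_mul]
          exact mul_inv_cancel₀ (hZpos t).ne')
      rw [hlogprod p hp, hlogprod _ (fun i => mul_pos (hp i)
        (mul_pos (Real.exp_pos _) (inv_pos.mpr (hZpos t)))), Real.exp_le_exp] at hq
      have e : ∑ i, u i * Real.log (p i * y i)
          = ∑ i, u i * Real.log (p i) + t * b - Real.log (Z t) := by
        have e1 : ∀ i, u i * Real.log (p i * y i)
            = u i * Real.log (p i) + t * ((A j i : ℝ) * u i) - u i * Real.log (Z t) := by
          intro i
          rw [Real.log_mul (hp i).ne' (mul_pos (Real.exp_pos _) (inv_pos.mpr (hZpos t))).ne',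
            Real.log_mul (Real.exp_pos _).ne' (inv_pos.mpr (hZpos t)).ne', Real.log_exp,
            Real.log_inv]
          ring
        rw [Finset.sum_congr rfl fun i _ => e1 i, Finset.sum_sub_distrib,
          Finset.sum_add_distrib, ← Finset.mul_sum, ← Finset.sum_mul, husum, one_mul]
      rw [e] at hq
      rw [← Real.le_log_iff_exp_le (hZpos t)]
      linarith
    have hd : HasDerivAt (fun t => Z t - Real.exp (t * b))
        ((∑ i, p i * (Real.exp (0 * (A j i : ℝ)) * (1 * (A j i : ℝ))))
          - Real.exp (0 * b) * (1 * b)) 0 := by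
      refine HasDerivAt.sub ?_ (((hasDerivAt_id' (0:ℝ)).mul_const b).exp)
      exact HasDerivAt.fun_sum fun i _ =>
        (((hasDerivAt_id' (0:ℝ)).mul_const (A j i : ℝ)).exp).const_mul (p i)
    have hmin : IsLocalMin (fun t => Z t - Real.exp (t * b)) 0 := by
      refine Filter.Eventually.of_forall fun t => ?_
      have := key t
      simp only [hZ, zero_mul, Real.exp_zero, mul_one, hpsum, sub_self]
      simp only [hZ] at this
      linarith
    have h0 := hmin.hasDerivAt_eq_zero hd
    simp only [zero_mul, Real.exp_zero, one_mul] at h0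
    rw [sub_eq_zero] at h0
    rw [← h0]
    exact Finset.sum_congr rfl fun i _ => mul_comm _ _
  · intro hA q hqM hq hqsum
    have hlin : ∀ x ∈ M, (∀ i, 0 < x i) → ∑ i, (u i - p i) * Real.log (x i) = 0 := by
      intro x hx hxp
      have hcont : ContinuousAt
          (fun x : Fin (n + 1) → ℝ => ∑ i, (u i - p i) * Real.log (x i)) x := by
        refine tendsto_finsetSum _ fun i _ => ?_
        exact ((continuousAt_apply i x).log (hxp i).ne').const_mul _
      rw [hM] at hx
      have hz : ∀ z ∈ S, ∑ i, (u i - p i) * Real.log (z i) = 0 := by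
        rintro z ⟨θ, hθ, hz⟩
        have e1 : ∀ i, (u i - p i) * Real.log (z i)
            = ∑ j, Real.log (θ j) * ((A j i : ℝ) * u i - (A j i : ℝ) * p i) := by
          intro i
          rw [hz i, Real.log_prod fun j _ => (pow_pos (hθ j) _).ne', Finset.mul_sum]
          refine Finset.sum_congr rfl fun j _ => ?_
          rw [Real.log_pow]
          ring
        rw [Finset.sum_congr rfl fun i _ => e1 i, Finset.sum_comm]
        refine Finset.sum_eq_zero fun j _ => ?_
        have hj := congrFun hA j
        simp only [Matrix.mulVec, dotProduct, Matrix.map_apply] at hj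
        rw [← Finset.mul_sum, Finset.sum_sub_distrib, hj, sub_self, mul_zero]
      have hmem := hcont.continuousWithinAt.mem_closure (t := {(0:ℝ)}) hx
        (fun z hzS => hz z hzS)
      simpa using hmem
    have hlq := hlin q hqM hq
    have hlp := hlin p hpM hp
    rw [hlogprod p hp, hlogprod q hq, Real.exp_le_exp]
    have hg : ∑ i, p i * Real.log (q i) - ∑ i, p i * Real.log (p i) ≤ 0 := by
      rw [← Finset.sum_sub_distrib]
      calc _ ≤ ∑ i, (q i - p i) := by
            refine Finset.sum_le_sum fun i _ => ?_
            have h := Real.log_le_sub_one_of_pos (div_pos (hq i) (hp i))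
            rw [Real.log_div (hq i).ne' (hp i).ne'] at h
            have h2 := mul_le_mul_of_nonneg_left h (hp i).le
            have h3 : p i * (q i / p i - 1) = q i - p i := by
              have := (hp i).ne'
              field_simp
            linarith
        _ = 0 := by rw [Finset.sum_sub_distrib, hqsum, hpsum, sub_self]
    simp only [sub_mul, Finset.sum_sub_distrib] at hlq hlp
    linarith
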